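/- Let I_max ≥ 6 and n ≥ 1 be integers, and set k = ⌊I_max/2⌋ − 2, n_A = ⌈n/k⌉, and n̄ = ⌈n/n_A⌉. Then the pair (n_A, n̄) is an optimal solution of the integer program: it is feasible, i.e. 2(n̄ + 2) ≤ I_max and n_A · n̄ ≥ n, and any pair of positive integers (n_A', n̄') satisfying 2(n̄' + 2) ≤ I_max and n_A' · n̄' ≥ n satisfies n_A' ≥ n_A. -/

import Mathlib

/-- `(n_A, n̄) = (⌈n/k⌉, ⌈n/n_A⌉)` with `k = ⌊I_max/2⌋ - 2` is an optimal solution of the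
integer program `min n_A s.t. 2(n̄+2) ≤ I_max, n_A · n̄ ≥ n` over positive integers. -/
theorem splitting_optimal (Imax n : ℤ) (hImax : 6 ≤ Imax) (hn : 1 ≤ n)
    (k nA nbar : ℤ)
    (hk : k = ⌊(Imax : ℚ) / 2⌋ - 2)
    (hnA : nA = ⌈(n : ℚ) / (k : ℚ)⌉)
    (hnbar : nbar = ⌈(n : ℚ) / (nA : ℚ)⌉) :
    (0 < nA ∧ 0 < nbar ∧ 2 * (nbar + 2) ≤ Imax ∧ n ≤ nA * nbar) ∧
      ∀ nA' nbar' : ℤ, 0 < nA' → 0 < nbar' →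
        2 * (nbar' + 2) ≤ Imax → n ≤ nA' * nbar' → nA ≤ nA' := by
  have key : ∀ a b : ℤ, 0 < b → ∀ z : ℤ, ⌈(a : ℚ) / (b : ℚ)⌉ ≤ z ↔ a ≤ z * b := by
    intro a b hb z
    have hb' : (0 : ℚ) < (b : ℚ) := by exact_mod_cast hb
    rw [Int.ceil_le, div_le_iff₀ hb']
    exact_mod_cast Iff.rfl
  have hk2 : ∀ z : ℤ, z ≤ k + 2 ↔ 2 * z ≤ Imax := by
    intro z
    have h1 : k + 2 = ⌊(Imax : ℚ) / 2⌋ := by omega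
    rw [h1, Int.le_floor, le_div_iff₀ (by norm_num : (0 : ℚ) < 2), mul_comm]
    exact_mod_cast Iff.rfl
  have hkpos : 0 < k := by
    have := (hk2 3).2 (by omega)
    omega
  have hA : ∀ z : ℤ, nA ≤ z ↔ n ≤ z * k := by
    intro z
    rw [hnA]
    exact key n k hkpos z
  have hApos : 0 < nA := by
    by_contra h
    have := (hA 0).1 (by omega)
    omega
  have hB : ∀ z : ℤ, nbar ≤ z ↔ n ≤ z * nA := by
    intro z
    rw [hnbar]
    exact key n nA hApos z
  refine ⟨⟨hApos, ?_, ?_, ?_⟩, ?_⟩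
  · by_contra h
    have := (hB 0).1 (by omega)
    omega
  · have h1 : nbar ≤ k := (hB k).2 (by
      rw [mul_comm]
      exact (hA nA).1 le_rfl)
    exact (hk2 (nbar + 2)).1 (by omega)
  · rw [mul_comm]
    exact (hB nbar).1 le_rfl
  · intro a b ha hb h1 h2
    have h3 : b ≤ k := by
      have := (hk2 (b + 2)).2 h1
      omega
    exact (hA a).2 (h2.trans (mul_le_mul_of_nonneg_left h3 ha.le))
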